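/- Let L ≥ 1 and let l_1, …, l_L be finite sequences of positive real numbers. Then ḡ( (l_1† ⧺ l_1) ⧺ (l_2† ⧺ l_2) ⧺ ⋯ ⧺ (l_L† ⧺ l_L) ) ≤ ( max_{1 ≤ a ≤ L} ḡ(l_a) )², where l† denotes the reversed sequence of inverses and ⧺ denotes concatenation. -/

import Mathlib

/-- `g(x) = max{x, 1/x}`. -/
noncomputable def gfun (x : ℝ) : ℝ := max x x⁻¹

/-- The squeezing parameter `ḡ` of a finite sequence of squeezing strengths:
the maximum of `g` over the products of all contiguous subsequences
(with the convention `ḡ = 1` for the empty sequence, realized by the empty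
contiguous subsequence). -/
noncomputable def gbar (l : List ℝ) : ℝ :=
  sSup {x : ℝ | ∃ l₁ l₂ l₃ : List ℝ, l = l₁ ++ l₂ ++ l₃ ∧ x = gfun l₂.prod}

/-- The adjoint sequence `l† = (η_T⁻¹, …, η_1⁻¹)`. -/
noncomputable def dagger (l : List ℝ) : List ℝ := (l.map fun x => x⁻¹).reverse

theorem gfun_le_iff {x M : ℝ} : gfun x ≤ M ↔ x ≤ M ∧ x⁻¹ ≤ M := max_le_iff

theorem gfun_inv (x : ℝ) : gfun x⁻¹ = gfun x := by
  simp [gfun, max_comm]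

theorem gfun_div_le {x y M : ℝ} (hx₀ : 0 < x) (hy₀ : 0 < y) (hx : gfun x ≤ M) (hy : gfun y ≤ M) :
    gfun (y / x) ≤ M ^ 2 := by
  rw [gfun_le_iff] at *
  have hM : 0 ≤ M := hx₀.le.trans hx.1
  rw [inv_div, sq, div_eq_mul_inv, div_eq_mul_inv]
  exact ⟨mul_le_mul hy.1 hx.2 (by positivity) hM, mul_le_mul hx.1 hy.2 (by positivity) hM⟩

theorem gfun_prod_le_gbar {l s : List ℝ} (h : s <:+: l) : gfun s.prod ≤ gbar l := by
  obtain ⟨l₁, l₃, rfl⟩ := h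
  refine le_csSup (Set.Finite.bddAbove ?_) ⟨l₁, s, l₃, rfl, rfl⟩
  refine ((List.finite_toSet (l₁ ++ s ++ l₃).sublists).image fun t => gfun t.prod).subset ?_
  rintro _ ⟨t₁, t₂, t₃, ht, rfl⟩
  exact ⟨t₂, List.mem_sublists.2 (List.IsInfix.sublist ⟨t₁, t₃, ht.symm⟩), rfl⟩

theorem gbar_le {l : List ℝ} {M : ℝ} (h : ∀ s, s <:+: l → gfun s.prod ≤ M) : gbar l ≤ M := by
  refine csSup_le ⟨_, [], [], l, rfl, rfl⟩ ?_
  rintro _ ⟨l₁, l₂, l₃, hl, rfl⟩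
  exact h l₂ ⟨l₁, l₃, hl.symm⟩

theorem one_le_gbar (l : List ℝ) : 1 ≤ gbar l := by
  simpa [gfun] using gfun_prod_le_gbar (List.nil_infix (l := l))

theorem prod_dagger (l : List ℝ) : (dagger l).prod = l.prod⁻¹ := by
  rw [dagger, List.prod_reverse, List.prod_inv]

theorem dagger_append (l m : List ℝ) : dagger (l ++ m) = dagger m ++ dagger l := by
  simp [dagger]

theorem dagger_dagger (l : List ℝ) : dagger (dagger l) = l := by
  simp [dagger]

theorem exists_suffix_of_prefix_dagger_append {l w : List ℝ} (hl : ∀ x ∈ l, 0 < x)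
    (hw : w <+: dagger l ++ l) : ∃ s, s <:+ l ∧ w.prod = s.prod⁻¹ := by
  obtain ⟨t, ht⟩ := hw
  rcases List.append_eq_append_iff.1 ht with ⟨u, hu, -⟩ | ⟨u, rfl, hu⟩
  · refine ⟨dagger w, ⟨dagger u, ?_⟩, by rw [prod_dagger, inv_inv]⟩
    rw [← dagger_append, ← hu, dagger_dagger]
  · refine ⟨t, ⟨u, hu.symm⟩, ?_⟩
    have hu₀ : u.prod ≠ 0 := (List.prod_pos fun x hx => hl x (by simp [hu, hx])).ne'
    rw [List.prod_append, prod_dagger, hu, List.prod_append, mul_inv_rev, mul_assoc,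
      inv_mul_cancel₀ hu₀, mul_one]

theorem gfun_prod_le_of_prefix_flatten {M : ℝ} (hM : 1 ≤ M) {B : List (List ℝ)}
    (hB : ∀ b ∈ B, b.prod = 1 ∧ ∀ v, v <+: b → gfun v.prod ≤ M) {w : List ℝ}
    (hw : w <+: B.flatten) : gfun w.prod ≤ M := by
  induction B generalizing w with
  | nil =>
    obtain rfl : w = [] := by simpa using hw
    simpa [gfun] using hM
  | cons b B ih =>
    obtain ⟨t, ht⟩ := hw
    rw [List.flatten_cons] at ht
    obtain ⟨hb₁, hb⟩ := hB b List.mem_cons_self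
    rcases List.append_eq_append_iff.1 ht with ⟨u, hu, -⟩ | ⟨u, rfl, hu⟩
    · exact hb w ⟨u, hu.symm⟩
    · rw [List.prod_append, hb₁, one_mul]
      exact ih (fun c hc => hB c (List.mem_cons_of_mem _ hc)) ⟨t, hu.symm⟩

theorem pos_of_mem_dagger {l : List ℝ} (hl : ∀ x ∈ l, 0 < x) {x : ℝ} (hx : x ∈ dagger l) :
    0 < x := by
  obtain ⟨y, hy, rfl⟩ : ∃ y ∈ l, y⁻¹ = x := by simpa [dagger] using hx
  exact inv_pos.2 (hl y hy)

theorem gbar_le_sq_of_prefix {l : List ℝ} (hl : ∀ x ∈ l, 0 < x) {M : ℝ}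
    (h : ∀ w, w <+: l → gfun w.prod ≤ M) : gbar l ≤ M ^ 2 := by
  refine gbar_le fun s hs => ?_
  obtain ⟨u, v, rfl⟩ := hs
  have hu₀ : 0 < u.prod := List.prod_pos fun x hx => hl x (by simp [hx])
  have hs₀ : 0 < s.prod := List.prod_pos fun x hx => hl x (by simp [hx])
  have hus := h (u ++ s) ⟨v, rfl⟩
  rw [List.prod_append] at hus
  have := gfun_div_le hu₀ (mul_pos hu₀ hs₀) (h u ⟨s ++ v, by simp⟩) hus
  rwa [mul_div_cancel_left₀ _ hu₀.ne'] at this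

/-- Lemma C.9 (moment-limits for dressed circuits):
`ḡ((l_1† ⧺ l_1) ⧺ ⋯ ⧺ (l_L† ⧺ l_L)) ≤ (max_a ḡ(l_a))²`. -/
theorem gbar_dressed_le_sq_max (L : ℕ) (hL : 1 ≤ L) (l : Fin L → List ℝ)
    (hpos : ∀ a, ∀ x ∈ l a, 0 < x) :
    gbar (List.ofFn fun a => dagger (l a) ++ l a).flatten ≤
      (Finset.univ.sup' (Finset.univ_nonempty_iff.mpr ⟨⟨0, hL⟩⟩)
          fun a => gbar (l a)) ^ 2 := by
  have hle : ∀ a, gbar (l a) ≤ Finset.univ.sup' (Finset.univ_nonempty_iff.mpr ⟨⟨0, hL⟩⟩)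
      fun a => gbar (l a) := fun a => Finset.le_sup' (fun a => gbar (l a)) (Finset.mem_univ a)
  refine gbar_le_sq_of_prefix ?_ fun w hw =>
    gfun_prod_le_of_prefix_flatten ((one_le_gbar _).trans (hle ⟨0, hL⟩)) ?_ hw
  · intro x hx
    obtain ⟨b, hb, hx⟩ := List.mem_flatten.1 hx
    obtain ⟨a, rfl⟩ := (List.mem_ofFn' _ _).1 hb
    exact (List.mem_append.1 hx).elim (pos_of_mem_dagger (hpos a)) (hpos a x)
  · intro b hb
    obtain ⟨a, rfl⟩ := (List.mem_ofFn' _ _).1 hb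
    refine ⟨?_, fun v hv => ?_⟩
    · rw [List.prod_append, prod_dagger, inv_mul_cancel₀ (List.prod_pos (hpos a)).ne']
    · obtain ⟨s, hs, hvs⟩ := exists_suffix_of_prefix_dagger_append (hpos a) hv
      rw [hvs, gfun_inv]
      exact (gfun_prod_le_gbar hs.isInfix).trans (hle a)
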